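/- arXiv:1908.09483 — 2 statements merged into one kernel-verified Lean document; each statement's English description precedes it below -/
import Mathlib

section
/- Assume that (f_n : ℝ)/p_n tends to 3 as n → ∞. Then there exists N such that every even number x > N can be written as x = p + q with prime numbers p ≤ q satisfying x/4 < p ≤ x/2. -/
open Filter Pointwise

/-- `nthPrime n` is the `n`-th prime number (1-indexed): `nthPrime 1 = 2`, etc. -/
noncomputable def nthPrime (n : ℕ) : ℕ := Nat.nth Nat.Prime (n - 1)

/-- `S n` is the additive submonoid of `ℕ` generated by the primes `q ≥ nthPrime n`. -/
def S (n : ℕ) : AddSubmonoid ℕ :=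
  AddSubmonoid.closure {q : ℕ | q.Prime ∧ nthPrime n ≤ q}

/-- `frob n` is the Frobenius number of `S n`: the largest natural number not in `S n`. -/
noncomputable def frob (n : ℕ) : ℕ := sSup {m : ℕ | m ∉ S n}

/-- `genus n` is the number of natural numbers not in `S n`. -/
noncomputable def genus (n : ℕ) : ℕ := {m : ℕ | m ∉ S n}.ncard

/-- `atoms n` is the minimal generating set `S n \ {0} \ ((S n \ {0}) + (S n \ {0}))`. -/
def atoms (n : ℕ) : Set ℕ :=
  ((S n : Set ℕ) \ {0}) \ (((S n : Set ℕ) \ {0}) + ((S n : Set ℕ) \ {0}))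

/-- `u n` is the largest atom of `S n`. -/
noncomputable def u (n : ℕ) : ℕ := sSup (atoms n)

/-- `e n` is the embedding dimension of `S n`: the number of atoms. -/
noncomputable def e (n : ℕ) : ℕ := (atoms n).ncard

theorem mem_S_of_frob_lt {n m : ℕ} (hm : frob n < m) : m ∈ S n := by
  obtain ⟨p, hp, hp'⟩ := Nat.exists_infinite_primes (nthPrime n)
  obtain ⟨q, hq, hq'⟩ := Nat.exists_infinite_primes (p + 1)
  have hbdd : BddAbove {m : ℕ | m ∉ S n} := by
    have hF := frobeniusNumber_pair ((Nat.coprime_primes hp' hq').2 (by omega))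
      hp'.one_lt hq'.one_lt
    refine ⟨p * q - p - q, fun k hk => ?_⟩
    by_contra! hlt
    refine hk ?_
    have hmem : k ∈ AddSubmonoid.closure ({p, q} : Set ℕ) := by
      by_contra hcon
      exact absurd (hF.2 hcon) (by omega)
    refine AddSubmonoid.closure_mono ?_ hmem
    rintro a (rfl | rfl)
    · exact ⟨hp', hp⟩
    · exact ⟨hq', by omega⟩
  by_contra hcon
  exact absurd (le_csSup hbdd hcon) (not_le.2 hm)

theorem nthPrime_count_add_one {p : ℕ} (hp : p.Prime) :
    nthPrime (Nat.count Nat.Prime p + 1) = p := by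
  simp [nthPrime, Nat.nth_count hp]

theorem mem_closure_primes_of_frob_asymptotic
    (h : Filter.Tendsto (fun n => (frob n : ℝ) / (nthPrime n : ℝ)) Filter.atTop (nhds 3)) :
    ∃ K : ℕ, ∀ p : ℕ, p.Prime → K ≤ p → ∀ m : ℕ, 31 * p ≤ 10 * m →
      m ∈ AddSubmonoid.closure {q : ℕ | q.Prime ∧ p ≤ q} := by
  obtain ⟨N, hN⟩ := Filter.eventually_atTop.1
    (h.eventually (gt_mem_nhds (show (3 : ℝ) < 31 / 10 by norm_num)))
  refine ⟨Nat.nth Nat.Prime N, fun p hp hKp m hm => ?_⟩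
  have hcount : N ≤ Nat.count Nat.Prime p + 1 := by
    have := Nat.count_monotone Nat.Prime hKp
    rw [Nat.count_nth_of_infinite Nat.infinite_setOfPred_prime] at this
    omega
  have hlt := hN _ hcount
  have hmem : m ∈ S (Nat.count Nat.Prime p + 1) := by
    apply mem_S_of_frob_lt
    rw [nthPrime_count_add_one hp, div_lt_iff₀ (by exact_mod_cast hp.pos)] at hlt
    have hm' : (31 : ℝ) * p ≤ 10 * m := by exact_mod_cast hm
    have : (frob (Nat.count Nat.Prime p + 1) : ℝ) < m := by linarith
    exact_mod_cast this
  rwa [S, nthPrime_count_add_one hp] at hmem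

/-- An element of the monoid generated by numbers at least `p` that is less than `4 * p` is a sum
of at most three generators. -/
theorem sum_le_three_of_mem_closure {T : Set ℕ} {p m : ℕ} (hT : ∀ a ∈ T, p ≤ a)
    (hm : m ∈ AddSubmonoid.closure T) (hlt : m < 4 * p) :
    m = 0 ∨ m ∈ T ∨ (∃ a ∈ T, ∃ b ∈ T, m = a + b) ∨
      ∃ a ∈ T, ∃ b ∈ T, ∃ c ∈ T, m = a + b + c := by
  obtain ⟨l, hl, rfl⟩ := AddSubmonoid.exists_list_of_mem_closure hm
  match l, hl, hlt with
  | [], _, _ => simp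
  | [a], hl, _ => exact Or.inr (Or.inl (by simpa using hl))
  | [a, b], hl, _ =>
    exact Or.inr (Or.inr (Or.inl ⟨a, hl a (by simp), b, hl b (by simp), by simp⟩))
  | [a, b, c], hl, _ =>
    exact Or.inr (Or.inr (Or.inr
      ⟨a, hl a (by simp), b, hl b (by simp), c, hl c (by simp), by simp [add_assoc]⟩))
  | a :: b :: c :: d :: l, hl, hlt =>
    have ha := hT a (hl a (by simp))
    have hb := hT b (hl b (by simp))
    have hc := hT c (hl c (by simp))
    have hd := hT d (hl d (by simp))
    simp only [List.sum_cons] at hlt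
    omega

/-- If the odd numbers slightly above `3 * p` lie in the monoid generated by the primes `q ≥ p`,
then there is a prime between `p` and `5 * p / 4`. -/
theorem exists_prime_lt_of_mem_closure {p : ℕ} (hp100 : 100 ≤ p)
    (hmem : ∀ m : ℕ, 31 * p ≤ 10 * m → m ∈ AddSubmonoid.closure {q : ℕ | q.Prime ∧ p ≤ q}) :
    ∃ q : ℕ, q.Prime ∧ p < q ∧ 4 * q < 5 * p := by
  by_contra! hgap
  have hodd : ∀ a : ℕ, a.Prime → p ≤ a → a % 2 = 1 := fun a ha hpa =>
    ha.eq_two_or_odd.resolve_left (by omega)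
  have hgap' : ∀ a : ℕ, a.Prime → p ≤ a → a = p ∨ 5 * p ≤ 4 * a := fun a ha hpa =>
    hpa.eq_or_lt.imp Eq.symm (hgap a ha)
  obtain ⟨x, hx1, hx2, hx6, hx5⟩ : ∃ x : ℕ, 31 * p ≤ 10 * x ∧ 2 * x < 7 * p ∧ x % 6 = 3 ∧
      (x - 2 * p) % 5 = 0 := by
    obtain ⟨A, hA⟩ : ∃ A : ℕ, A = 31 * p / 10 + 1 := ⟨_, rfl⟩
    exact ⟨A + (15 + 12 * p + 29 * A) % 30, by omega, by omega, by omega, by omega⟩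
  have hnot : ¬ (x - 2 * p).Prime := fun hpr => by
    have := (Nat.prime_dvd_prime_iff_eq Nat.prime_five hpr).1 (Nat.dvd_of_mod_eq_zero hx5)
    omega
  rcases sum_le_three_of_mem_closure (fun a ha => ha.2) (hmem x hx1) (by omega) with
    h0 | ⟨hpr, -⟩ | ⟨a, ⟨ha, hpa⟩, b, ⟨hb, hpb⟩, rfl⟩ |
    ⟨a, ⟨ha, hpa⟩, b, ⟨hb, hpb⟩, c, ⟨hc, hpc⟩, hxs⟩
  · omega
  · have := (Nat.prime_dvd_prime_iff_eq Nat.prime_three hpr).1 (by omega)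
    omega
  · have := hodd a ha hpa
    have := hodd b hb hpb
    omega
  · have hcase : x - 2 * p = a ∨ x - 2 * p = b ∨ x - 2 * p = c := by
      have := hgap' a ha hpa
      have := hgap' b hb hpb
      have := hgap' c hc hpc
      omega
    rcases hcase with h | h | h <;> rw [h] at hnot <;> contradiction

theorem goldbach_of_frob_asymptotic
    (h : Filter.Tendsto (fun n => (frob n : ℝ) / (nthPrime n : ℝ)) Filter.atTop (nhds 3)) :
    ∃ N : ℕ, ∀ x : ℕ, N < x → Even x →
    ∃ p q : ℕ, p.Prime ∧ q.Prime ∧ p ≤ q ∧ x = p + q ∧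
      x < 4 * p ∧ 2 * p ≤ x := by
  obtain ⟨K, hK⟩ := mem_closure_primes_of_frob_asymptotic h
  obtain ⟨r, hr, hrp⟩ := Nat.exists_infinite_primes (K + 100)
  refine ⟨4 * r, fun x hx hxe => ?_⟩
  have hx2 : x % 2 = 0 := Nat.even_iff.1 hxe
  have hrx : r ≤ x / 4 := by omega
  obtain ⟨s, hs⟩ : ∃ s, s = Nat.findGreatest Nat.Prime (x / 4) := ⟨_, rfl⟩
  have hsp : s.Prime := hs ▸ Nat.findGreatest_spec hrx hrp
  have hrs : r ≤ s := hs ▸ Nat.le_findGreatest hrx hrp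
  have hsx : s ≤ x / 4 := hs ▸ Nat.findGreatest_le _
  obtain ⟨p, hp, hsp', hps⟩ :=
    exists_prime_lt_of_mem_closure (by omega) (hK s hsp (by omega))
  have hxp : x < 4 * p := by
    by_contra! hle
    have : p ≤ s := hs ▸ Nat.le_findGreatest (by omega) hp
    omega
  have hodd : ∀ a : ℕ, a.Prime → p ≤ a → a % 2 = 1 := fun a ha hpa =>
    ha.eq_two_or_odd.resolve_left (by omega)
  rcases sum_le_three_of_mem_closure (fun a ha => ha.2) (hK p hp (by omega) x (by omega)) hxp with
    h0 | ⟨hpr, hpx⟩ | ⟨a, ⟨ha, hpa⟩, b, ⟨hb, hpb⟩, hxs⟩ |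
    ⟨a, ⟨ha, hpa⟩, b, ⟨hb, hpb⟩, c, ⟨hc, hpc⟩, hxs⟩
  · omega
  · have := hodd x hpr hpx
    omega
  · rcases le_total a b with hab | hab
    · exact ⟨a, b, ha, hb, hab, hxs, by omega, by omega⟩
    · exact ⟨b, a, hb, ha, hab, by omega, by omega, by omega⟩
  · have := hodd a ha hpa
    have := hodd b hb hpb
    have := hodd c hc hpc
    omega
end

section
/- For every n ≥ 1, Wilf's inequality holds for S_n: g_n / (1 + f_n) ≤ (e_n − 1)/e_n, equivalently e_n · (1 + f_n − g_n) ≥ 1 + f_n. -/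
open Filter Pointwise

theorem centralBinom_le_pow_card_primes {n : ℕ} (hn : 2 < n) :
    n.centralBinom ≤ (2 * n) ^ (Nat.sqrt (2 * n) + {q ∈ Finset.Ioc n (2 * n) | q.Prime}.card) *
      4 ^ (2 * n / 3) := by
  let f x := x ^ n.centralBinom.factorization x
  have hprod : n.centralBinom = ∏ x ∈ Finset.range (2 * n + 1) with x.Prime, f x := by
    rw [Finset.prod_filter_of_ne, n.prod_pow_factorization_centralBinom]
    intro p _ h
    contrapose h
    dsimp only [f]
    rw [Nat.factorization_eq_zero_of_not_prime n.centralBinom h, pow_zero]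
  rw [hprod, ← Finset.prod_filter_mul_prod_filter_not _ (fun q => q ≤ Nat.sqrt (2 * n) ∨ n < q)]
  apply mul_le_mul'
  · refine (Finset.prod_le_prod' fun p _ => (?_ : f p ≤ 2 * n)).trans ?_
    · exact Nat.pow_factorization_choose_le (by lia)
    rw [Finset.prod_const]
    refine pow_right_mono₀ (by lia) ?_
    calc _ ≤ (Finset.Icc 1 (Nat.sqrt (2 * n)) ∪ {q ∈ Finset.Ioc n (2 * n) | q.Prime}).card := by
          refine Finset.card_le_card fun q hq => ?_
          simp only [Finset.mem_filter, Finset.mem_range, Finset.mem_union, Finset.mem_Icc,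
            Finset.mem_Ioc] at hq ⊢
          have := hq.1.2.one_lt
          grind
      _ ≤ _ := by
          grw [Finset.card_union_le]
          simp
  · refine le_trans ?_ (primorial_le_four_pow (2 * n / 3))
    rw [primorial]
    have hle : ∀ q ∈ {q ∈ Finset.range (2 * n + 1) | q.Prime}.filter
        (fun q => ¬ (q ≤ Nat.sqrt (2 * n) ∨ n < q)), f q ≤ if q ≤ 2 * n / 3 then q else 1 := by
      intro q hq
      simp only [Finset.mem_filter, Finset.mem_range, not_or, not_le, not_lt] at hq
      obtain ⟨⟨-, hp⟩, hs, hqn⟩ := hq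
      split_ifs with h
      · exact (pow_right_mono₀ hp.one_lt.le
          (Nat.factorization_choose_le_one (Nat.sqrt_lt'.mp hs))).trans (pow_one q).le
      · dsimp only [f]
        rw [Nat.factorization_centralBinom_of_two_mul_self_lt_three_mul hn hqn (by lia), pow_zero]
    refine (Finset.prod_le_prod' hle).trans ?_
    rw [← Finset.prod_filter]
    refine Finset.prod_le_prod_of_subset_of_one_le' (fun q hq => ?_) fun q hq _ => ?_
    · simp only [Finset.mem_filter, Finset.mem_range] at hq ⊢
      exact ⟨by lia, hq.1.1.2⟩
    · exact (Finset.mem_filter.1 hq).2.one_lt.le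

theorem thirtySix_mul_sq_le_two_pow {t : ℕ} (ht : 13 ≤ t) : 36 * (t + 2) ^ 2 ≤ 2 ^ t := by
  induction t, ht using Nat.le_induction with
  | base => norm_num
  | succ t ht ih =>
    have : (t + 1 + 2) ^ 2 ≤ 2 * (t + 2) ^ 2 := by nlinarith
    rw [pow_succ]
    lia

theorem three_mul_le_sq_card_primes {n : ℕ} (hn : 8192 ≤ n) :
    3 * n ≤ {q ∈ Finset.Ioc n (2 * n) | q.Prime}.card ^ 2 := by
  set k := {q ∈ Finset.Ioc n (2 * n) | q.Prime}.card with hk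
  by_contra! hlt
  set s := Nat.sqrt (2 * n)
  have hs : s ^ 2 ≤ 2 * n := Nat.sqrt_le' _
  obtain ⟨t, ht⟩ : ∃ t, t = Nat.log 2 n := ⟨_, rfl⟩
  have ht13 : 13 ≤ t := ht ▸ Nat.le_log_of_pow_le (by norm_num) (by lia)
  have hlow : 2 ^ t ≤ n := ht ▸ Nat.pow_log_le_self 2 (by lia)
  have hup : 2 * n ≤ 2 ^ (t + 2) := by
    have := Nat.lt_pow_succ_log_self (b := 2) (by norm_num) n
    rw [← ht] at this
    rw [pow_succ]
    lia
  have hpow : 4 ^ n < (2 ^ (t + 2)) ^ (s + k + 1) * 4 ^ (2 * n / 3) := calc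
    4 ^ n < n * n.centralBinom := Nat.four_pow_lt_mul_centralBinom n (by lia)
    _ ≤ (2 * n) * ((2 * n) ^ (s + k) * 4 ^ (2 * n / 3)) := by
      gcongr
      · lia
      · exact centralBinom_le_pow_card_primes (by lia)
    _ = (2 * n) ^ (s + k + 1) * 4 ^ (2 * n / 3) := by ring
    _ ≤ _ := by gcongr
  rw [show 4 = 2 ^ 2 by rfl, ← pow_mul, ← pow_mul, ← pow_mul, ← pow_add,
    Nat.pow_lt_pow_iff_right (by norm_num)] at hpow
  have hexp : 2 * n < 3 * ((t + 2) * (s + k + 1)) := by lia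
  have hsq := (thirtySix_mul_sq_le_two_pow ht13).trans hlow
  zify at *
  nlinarith [sq_nonneg (18 * (t + 2) - (s + k) : ℤ), sq_nonneg (3 * s - 2 * k : ℤ)]

/-- The conditions on the numbers `a`, `b` of primes in `[p, 2p)` and `[p, 3p)` under which counting
translates of primes by multiples of `p` gives Wilf's inequality. -/
def WilfCounts (p a b : ℕ) : Prop :=
  2 * p ≤ b * (1 + a) ∧ 3 * p ≤ b * (2 + a) + 1 ∧ p ≤ b * a

instance (p a b : ℕ) : Decidable (WilfCounts p a b) := inferInstanceAs (Decidable (_ ∧ _ ∧ _))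

theorem WilfCounts.mono {p a b a' b' : ℕ} (h : WilfCounts p a b) (ha : a ≤ a') (hb : b ≤ b') :
    WilfCounts p a' b' := by
  obtain ⟨h₁, h₂, h₃⟩ := h
  refine ⟨?_, ?_, ?_⟩ <;> grw [← ha, ← hb] <;> assumption

theorem WilfCounts.of_sq {p a b : ℕ} (h : 3 * p ≤ a ^ 2) (hab : a ≤ b) : WilfCounts p a b := by
  have := Nat.mul_le_mul_right a hab
  refine ⟨?_, ?_, ?_⟩ <;> nlinarith

/-- `primesIn a b` is the finite set of primes in `[a, b)`. -/
def primesIn (a b : ℕ) : Finset ℕ := {q ∈ Finset.Ico a b | q.Prime}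

theorem mem_primesIn {a b q : ℕ} : q ∈ primesIn a b ↔ (a ≤ q ∧ q < b) ∧ q.Prime := by
  simp [primesIn]

theorem primesIn_subset {a b c d : ℕ} (h : c ≤ a) (h' : b ≤ d) : primesIn a b ⊆ primesIn c d :=
  Finset.filter_subset_filter _ (Finset.Ico_subset_Ico h h')

theorem wilfCounts_of_lt_23 : ∀ p < 23, p.Prime → 5 ≤ p →
    WilfCounts p (primesIn p (2 * p)).card (primesIn p (3 * p)).card := by
  decide +kernel

/-- A number below `c ^ 2` that is coprime to all primes below `c` is prime. -/
theorem prime_of_coprime {c P q : ℕ} (hP : ∀ r < c, r.Prime → r ∣ P) (hq : 1 < q)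
    (hqc : q < c ^ 2) (h : q.Coprime P) : q.Prime := by
  by_contra hnp
  have hmin := Nat.minFac_prime hq.ne'
  have hlt : q.minFac < c := by
    have := Nat.minFac_sq_le_self (by lia) hnp
    exact lt_of_pow_lt_pow_left₀ 2 (Nat.zero_le _) (this.trans_lt hqc)
  exact Nat.not_coprime_of_dvd_of_dvd hmin.one_lt q.minFac_dvd (hP _ hlt hmin) h

theorem wilfCounts_of_coprime_of_lt_144 : ∀ p < 144, 23 ≤ p → p.Coprime 9699690 →
    WilfCounts p {q ∈ Finset.Ico p (2 * p) | q.Coprime 9699690}.card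
      {q ∈ Finset.Ico p (3 * p) | q.Coprime 9699690}.card := by
  decide +kernel

theorem wilfCounts_of_lt_144 {p : ℕ} (hp : p.Prime) (h5 : 5 ≤ p) (hlt : p < 144) :
    WilfCounts p (primesIn p (2 * p)).card (primesIn p (3 * p)).card := by
  by_cases h23 : p < 23
  · exact wilfCounts_of_lt_23 p h23 hp h5
  have hprime : ∀ r < 23, r.Prime → r ∣ 9699690 := by decide +kernel
  have hle : ∀ m, m ≤ 3 * p →
      {q ∈ Finset.Ico p m | q.Coprime 9699690}.card ≤ (primesIn p m).card := by
    refine fun m hm => Finset.card_le_card fun q hq => ?_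
    rw [Finset.mem_filter, Finset.mem_Ico] at hq
    exact mem_primesIn.2 ⟨hq.1, prime_of_coprime hprime (by lia) (by lia) hq.2⟩
  refine (wilfCounts_of_coprime_of_lt_144 p hlt (by lia) ?_).mono (hle _ (by lia)) (hle _ le_rfl)
  rw [hp.coprime_iff_not_dvd, show 9699690 = 2 * 3 * 5 * 7 * 11 * 13 * 17 * 19 by norm_num]
  simp only [hp.dvd_mul]
  intro h
  rcases h with (((((((h | h) | h) | h) | h) | h) | h) | h) <;>
  · have := Nat.le_of_dvd (by decide) h
    lia

/-- `coprimeCount P d a` is the number of `q ∈ [a, a + 2 ^ d)` coprime to `P`, computed by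
bisection. -/
def coprimeCount (P : ℕ) : ℕ → ℕ → ℕ
  | 0, a => if a.gcd P = 1 then 1 else 0
  | d + 1, a => coprimeCount P d a + coprimeCount P d (a + 2 ^ d)

theorem card_primesIn_add {a b c : ℕ} (hab : a ≤ b) (hbc : b ≤ c) :
    (primesIn a b).card + (primesIn b c).card = (primesIn a c).card := by
  rw [primesIn, primesIn, primesIn, ← Finset.Ico_union_Ico_eq_Ico hab hbc, Finset.filter_union,
    Finset.card_union_of_disjoint]
  exact Finset.disjoint_filter_filter (Finset.Ico_disjoint_Ico_consecutive a b c)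

theorem coprimeCount_le {c P : ℕ} (hP : ∀ r < c, r.Prime → r ∣ P) (d a : ℕ) (ha : 1 < a)
    (hc : a + 2 ^ d ≤ c ^ 2) : coprimeCount P d a ≤ (primesIn a (a + 2 ^ d)).card := by
  induction d generalizing a with
  | zero =>
    rw [coprimeCount]
    split_ifs with h
    · refine Finset.card_pos.2 ⟨a, mem_primesIn.2 ⟨by simp, ?_⟩⟩
      exact prime_of_coprime hP ha (by lia) h
    · exact Nat.zero_le _
  | succ d ih =>
    rw [pow_succ, mul_two, ← add_assoc] at hc ⊢
    rw [coprimeCount, ← card_primesIn_add (Nat.le_add_right a (2 ^ d)) (Nat.le_add_right _ _)]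
    exact Nat.add_le_add (ih a ha (by lia)) (ih _ (by lia) hc)

/-- The product of the primes below `101`. -/
def primesProd : ℕ := 2305567963945518424753102147331756070

theorem dvd_primesProd : ∀ r < 101, r.Prime → r ∣ primesProd := by
  decide +kernel

theorem three_mul_le_sq_of_coprimeCount (b d d' : ℕ) {a p : ℕ} (hpb : p ≤ b) (hb : 1 < b)
    (hc : b + 2 ^ d + 2 ^ d' ≤ 101 ^ 2) (ha : b + 2 ^ d + 2 ^ d' ≤ 2 * a)
    (h : 3 * b ≤ (coprimeCount primesProd d b + coprimeCount primesProd d' (b + 2 ^ d)) ^ 2)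
    (hlt : p < a → 3 * p ≤ (primesIn p (2 * p)).card ^ 2) :
    3 * p ≤ (primesIn p (2 * p)).card ^ 2 := by
  by_cases hpa : p < a
  · exact hlt hpa
  calc 3 * p ≤ 3 * b := by lia
    _ ≤ _ := h
    _ ≤ ((primesIn b (b + 2 ^ d)).card +
          (primesIn (b + 2 ^ d) (b + 2 ^ d + 2 ^ d')).card) ^ 2 := by
      gcongr
      · exact coprimeCount_le dvd_primesProd d b hb (by lia)
      · exact coprimeCount_le dvd_primesProd d' _ (by lia) hc
    _ = (primesIn b (b + 2 ^ d + 2 ^ d')).card ^ 2 := by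
      rw [card_primesIn_add (by lia) (by lia)]
    _ ≤ _ := by
      gcongr
      exact primesIn_subset hpb (by lia)

theorem three_mul_le_sq_of_le_8192 {p : ℕ} (h₁ : 144 ≤ p) (h₂ : p ≤ 8192) :
    3 * p ≤ (primesIn p (2 * p)).card ^ 2 := by
  refine three_mul_le_sq_of_coprimeCount 8192 10 9 (a := 4864) h₂
    (by decide) (by decide) (by decide) (by decide +kernel) fun h => ?_
  refine three_mul_le_sq_of_coprimeCount 4864 9 9 (a := 2944) h.le
    (by decide) (by decide) (by decide) (by decide +kernel) fun h => ?_
  refine three_mul_le_sq_of_coprimeCount 2944 9 8 (a := 1856) h.le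
    (by decide) (by decide) (by decide) (by decide +kernel) fun h => ?_
  refine three_mul_le_sq_of_coprimeCount 1856 9 6 (a := 1216) h.le
    (by decide) (by decide) (by decide) (by decide +kernel) fun h => ?_
  refine three_mul_le_sq_of_coprimeCount 1216 8 8 (a := 864) h.le
    (by decide) (by decide) (by decide) (by decide +kernel) fun h => ?_
  refine three_mul_le_sq_of_coprimeCount 864 8 7 (a := 624) h.le
    (by decide) (by decide) (by decide) (by decide +kernel) fun h => ?_
  refine three_mul_le_sq_of_coprimeCount 624 8 6 (a := 472) h.le
    (by decide) (by decide) (by decide) (by decide +kernel) fun h => ?_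
  refine three_mul_le_sq_of_coprimeCount 472 7 7 (a := 364) h.le
    (by decide) (by decide) (by decide) (by decide +kernel) fun h => ?_
  refine three_mul_le_sq_of_coprimeCount 364 7 7 (a := 310) h.le
    (by decide) (by decide) (by decide) (by decide +kernel) fun h => ?_
  refine three_mul_le_sq_of_coprimeCount 310 7 6 (a := 251) h.le
    (by decide) (by decide) (by decide) (by decide +kernel) fun h => ?_
  refine three_mul_le_sq_of_coprimeCount 251 7 6 (a := 222) h.le
    (by decide) (by decide) (by decide) (by decide +kernel) fun h => ?_
  refine three_mul_le_sq_of_coprimeCount 222 7 5 (a := 191) h.le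
    (by decide) (by decide) (by decide) (by decide +kernel) fun h => ?_
  refine three_mul_le_sq_of_coprimeCount 191 6 6 (a := 160) h.le
    (by decide) (by decide) (by decide) (by decide +kernel) fun h => ?_
  refine three_mul_le_sq_of_coprimeCount 160 6 6 (a := 144) h.le
    (by decide) (by decide) (by decide) (by decide +kernel) fun h => ?_
  lia

theorem wilfCounts_card_primesIn {p : ℕ} (hp : p.Prime) (h5 : 5 ≤ p) :
    WilfCounts p (primesIn p (2 * p)).card (primesIn p (3 * p)).card := by
  by_cases h144 : p < 144
  · exact wilfCounts_of_lt_144 hp h5 h144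
  refine .of_sq ?_ (Finset.card_le_card (primesIn_subset le_rfl (by lia)))
  by_cases h : p ≤ 8192
  · exact three_mul_le_sq_of_le_8192 (by lia) h
  refine (three_mul_le_sq_card_primes (n := p) (by lia)).trans ?_
  gcongr
  intro q hq
  simp only [Finset.mem_filter, Finset.mem_Ioc] at hq
  refine mem_primesIn.2 ⟨⟨by lia, lt_of_le_of_ne hq.1.2 ?_⟩, hq.2⟩
  rintro rfl
  exact Nat.not_prime_mul (by lia) (by lia) hq.2

theorem prime_nthPrime (n : ℕ) : (nthPrime n).Prime := Nat.prime_nth_prime _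

theorem prime_mem_S {n q : ℕ} (hq : q.Prime) (h : nthPrime n ≤ q) : q ∈ S n :=
  AddSubmonoid.subset_closure ⟨hq, h⟩

theorem mul_mem_S {n m : ℕ} (k : ℕ) (h : m ∈ S n) : k * m ∈ S n := by
  simpa using (S n).nsmul_mem h k

theorem mem_S_cases {n m : ℕ} (hp : 3 ≤ nthPrime n) (h : m ∈ S n) :
    m = 0 ∨ (m.Prime ∧ Odd m ∧ nthPrime n ≤ m) ∨ (Even m ∧ 2 * nthPrime n ≤ m) ∨
      3 * nthPrime n ≤ m := by
  induction h using AddSubmonoid.closure_induction with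
  | mem q hq => exact .inr (.inl ⟨hq.1, hq.1.odd_of_ne_two (by have := hq.2; lia), hq.2⟩)
  | zero => exact .inl rfl
  | add x y _ _ hx hy =>
    rcases hx with rfl | ⟨hx, hx', hx''⟩ | ⟨hx, hx'⟩ | hx
    · simpa using hy
    · rcases hy with rfl | ⟨hy, hy', hy''⟩ | ⟨hy, hy'⟩ | hy
      · simp [hx, hx', hx'']
      · exact .inr (.inr (.inl ⟨hx'.add_odd hy', by lia⟩))
      · exact .inr (.inr (.inr (by lia)))
      · exact .inr (.inr (.inr (by lia)))
    · rcases hy with rfl | ⟨hy, hy', hy''⟩ | ⟨hy, hy'⟩ | hy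
      · simp [hx, hx']
      · exact .inr (.inr (.inr (by lia)))
      · exact .inr (.inr (.inl ⟨hx.add hy, by lia⟩))
      · exact .inr (.inr (.inr (by lia)))
    · exact .inr (.inr (.inr (by lia)))

theorem nthPrime_le_of_mem_S {n m : ℕ} (h : m ∈ S n) (h0 : m ≠ 0) : nthPrime n ≤ m := by
  have : m = 0 ∨ nthPrime n ≤ m := by
    induction h using AddSubmonoid.closure_induction with
    | mem q hq => exact .inr hq.2
    | zero => exact .inl rfl
    | add x y _ _ hx hy => lia
  exact this.resolve_left h0

theorem bddAbove_gaps (n : ℕ) : BddAbove {m : ℕ | m ∉ S n} := by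
  obtain ⟨q, hq, hqp⟩ := Nat.exists_infinite_primes (nthPrime n + 1)
  have hp := prime_nthPrime n
  have hcop : (nthPrime n).Coprime q := (Nat.coprime_primes hp hqp).2 (by lia)
  refine ⟨_, fun m hm => (frobeniusNumber_pair hcop hp.one_lt hqp.one_lt).2 fun h => hm ?_⟩
  refine AddSubmonoid.closure_mono ?_ h
  rintro x (rfl | rfl)
  exacts [⟨hp, le_rfl⟩, ⟨hqp, by lia⟩]

theorem le_frob {n m : ℕ} (h : m ∉ S n) : m ≤ frob n := le_csSup (bddAbove_gaps n) h

theorem frob_notMem (n : ℕ) : frob n ∉ S n := by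
  refine Nat.sSup_mem (s := {m : ℕ | m ∉ S n}) ⟨1, fun h => ?_⟩ (bddAbove_gaps n)
  have := nthPrime_le_of_mem_S h one_ne_zero
  have := (prime_nthPrime n).two_le
  lia

theorem finite_atoms (n : ℕ) : (atoms n).Finite := by
  refine (Set.finite_Iic (frob n + nthPrime n)).subset fun m hm => ?_
  by_contra! hlt
  rw [Set.mem_Iic, not_le] at hlt
  have hp := (prime_nthPrime n).pos
  refine hm.2 ⟨m - nthPrime n, ⟨?_, ?_⟩, nthPrime n, ⟨prime_mem_S (prime_nthPrime n) le_rfl, hp.ne'⟩,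
    Nat.sub_add_cancel (by lia)⟩
  · by_contra h
    have := le_frob h
    lia
  · rw [Set.mem_singleton_iff]
    lia

theorem card_le_e {n : ℕ} {s : Finset ℕ} (h : ∀ q ∈ s, q ∈ atoms n) : s.card ≤ e n := by
  rw [e, ← Set.ncard_coe_finset]
  exact Set.ncard_le_ncard h (finite_atoms n)

theorem prime_mem_atoms_of_lt_two_mul {n q : ℕ} (hq : q.Prime) (h : nthPrime n ≤ q)
    (hlt : q < 2 * nthPrime n) : q ∈ atoms n := by
  refine ⟨⟨prime_mem_S hq h, hq.ne_zero⟩, ?_⟩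
  rintro ⟨x, ⟨hx, hx0⟩, y, ⟨hy, hy0⟩, rfl⟩
  have := nthPrime_le_of_mem_S hx hx0
  have := nthPrime_le_of_mem_S hy hy0
  lia

theorem prime_mem_atoms_of_lt_three_mul {n q : ℕ} (hp : 3 ≤ nthPrime n) (hq : q.Prime)
    (h : nthPrime n ≤ q) (hlt : q < 3 * nthPrime n) : q ∈ atoms n := by
  refine ⟨⟨prime_mem_S hq h, hq.ne_zero⟩, ?_⟩
  rintro ⟨x, ⟨hx, hx0⟩, y, ⟨hy, hy0⟩, rfl⟩
  have hodd := hq.odd_of_ne_two (by lia)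
  have hxp := nthPrime_le_of_mem_S hx hx0
  have hyp := nthPrime_le_of_mem_S hy hy0
  rcases mem_S_cases hp hx with hx | ⟨-, hx, -⟩ | ⟨-, hx⟩ | hx
  · exact hx0 hx
  · rcases mem_S_cases hp hy with hy | ⟨-, hy, -⟩ | ⟨-, hy⟩ | hy
    · exact hy0 hy
    · exact Nat.not_even_iff_odd.2 hodd (hx.add_odd hy)
    · lia
    · lia
  · lia
  · lia

open Classical in
/-- The elements of `S n` up to its Frobenius number. -/
noncomputable def leftElements (n : ℕ) : Finset ℕ := {m ∈ Finset.range (1 + frob n) | m ∈ S n}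

theorem mem_leftElements {n m : ℕ} : m ∈ leftElements n ↔ m < 1 + frob n ∧ m ∈ S n := by
  simp [leftElements]

theorem genus_add_card_leftElements (n : ℕ) :
    genus n + (leftElements n).card = 1 + frob n := by
  classical
  have : {m : ℕ | m ∉ S n} = ({m ∈ Finset.range (1 + frob n) | m ∉ S n} : Finset ℕ) := by
    ext m
    simp only [Set.mem_ofPred_eq, Finset.coe_filter, Finset.mem_range]
    exact ⟨fun h => ⟨by have := le_frob h; lia, h⟩, fun h => h.2⟩
  rw [genus, this, Set.ncard_coe_finset, leftElements, add_comm]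
  convert Finset.card_filter_add_card_filter_not (s := Finset.range (1 + frob n)) (· ∈ S n) using 2
  simp

/-- Translating the primes in `[p, 2p)` by multiples of `p` produces elements of `S n`. -/
theorem card_le_card_leftElements {n j r : ℕ} (hj : 2 ≤ j)
    (hf : 1 + frob n = j * nthPrime n + r) :
    1 + (primesIn (nthPrime n) (2 * nthPrime n)).card * (j - 1) + min r 1 ≤
      (leftElements n).card := by
  classical
  set p := nthPrime n with hp
  have hpos : 0 < p := (prime_nthPrime n).pos
  have hpS : p ∈ S n := prime_mem_S (prime_nthPrime n) le_rfl
  set A := (primesIn p (2 * p) ×ˢ Finset.range (j - 1)).image fun x => x.1 + x.2 * p with hA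
  have hAcard : A.card = (primesIn p (2 * p)).card * (j - 1) := by
    rw [hA, Finset.card_image_of_injOn, Finset.card_product, Finset.card_range]
    rintro ⟨q, i⟩ hq ⟨q', i'⟩ hq' h
    simp only [Finset.coe_product, Set.mem_prod, Finset.mem_coe, mem_primesIn] at hq hq' h
    have hii : i = i' := by
      rcases lt_trichotomy i i' with hlt | heq | hlt
      · have := Nat.mul_le_mul_right p (Nat.succ_le_of_lt hlt)
        rw [Nat.succ_mul] at this
        lia
      · exact heq
      · have := Nat.mul_le_mul_right p (Nat.succ_le_of_lt hlt)
        rw [Nat.succ_mul] at this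
        lia
    subst hii
    simpa using h
  have hAmem : ∀ m ∈ A, m ∈ S n ∧ p ≤ m ∧ m < j * p := by
    intro m hm
    simp only [hA, Finset.mem_image, Finset.mem_product, mem_primesIn, Finset.mem_range,
      Prod.exists] at hm
    obtain ⟨q, i, ⟨⟨⟨hq, hq'⟩, hqp⟩, hi⟩, rfl⟩ := hm
    refine ⟨add_mem (prime_mem_S hqp hq) (mul_mem_S i hpS), by lia, ?_⟩
    have := Nat.mul_le_mul_right p (show i + 2 ≤ j by lia)
    rw [Nat.add_mul] at this
    lia
  set B : Finset ℕ := if r = 0 then ∅ else {j * p} with hB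
  have hBcard : B.card = min r 1 := by
    rw [hB]
    split_ifs with h
    · simp [h]
    · simp only [Finset.card_singleton]
      lia
  have hBmem : ∀ m ∈ B, m = j * p ∧ r ≠ 0 := by
    intro m hm
    rw [hB] at hm
    split_ifs at hm with h
    · simp at hm
    · exact ⟨by simpa using hm, h⟩
  have hdisj : Disjoint ({0} ∪ A) B := by
    rw [Finset.disjoint_left]
    intro m hm hmB
    have hjp := Nat.mul_pos (show 0 < j by lia) hpos
    rw [(hBmem m hmB).1] at hm
    rcases Finset.mem_union.1 hm with hm | hm
    · rw [Finset.mem_singleton] at hm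
      lia
    · exact (hAmem _ hm).2.2.false
  have hdisj' : Disjoint {0} A := by
    rw [Finset.disjoint_singleton_left]
    intro h
    have := (hAmem 0 h).2.1
    lia
  rw [← hAcard, ← hBcard, ← Finset.card_singleton 0, ← Finset.card_union_of_disjoint hdisj',
    ← Finset.card_union_of_disjoint hdisj]
  refine Finset.card_le_card fun m hm => mem_leftElements.2 ?_
  rw [Finset.mem_union, Finset.mem_union, Finset.mem_singleton] at hm
  rcases hm with (rfl | hm) | hm
  · exact ⟨by lia, zero_mem _⟩
  · have := hAmem m hm
    exact ⟨by lia, this.1⟩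
  · obtain ⟨rfl, hr⟩ := hBmem m hm
    exact ⟨by lia, mul_mem_S j hpS⟩

theorem two_mul_le_frob {n : ℕ} (h5 : 5 ≤ nthPrime n) : 2 * nthPrime n ≤ 1 + frob n := by
  have hodd : Odd (nthPrime n) := (prime_nthPrime n).odd_of_ne_two (by lia)
  have : 3 * (nthPrime n - 2) ∉ S n := by
    intro h
    rcases mem_S_cases (by lia) h with h | ⟨h, -, -⟩ | ⟨h, -⟩ | h
    · lia
    · exact Nat.not_prime_mul (by lia) (by lia) h
    · obtain ⟨k, hk⟩ := hodd
      obtain ⟨l, hl⟩ := h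
      lia
    · lia
  have := le_frob this
  lia

theorem mul_le_of_wilfCounts {p a b j r L : ℕ} (h : WilfCounts p a b) (hj : 2 ≤ j) (hr : r < p)
    (hL : 1 + a * (j - 1) + min r 1 ≤ L) : j * p + r ≤ b * L := by
  obtain ⟨i, rfl⟩ := Nat.exists_eq_add_of_le hj
  obtain ⟨h₁, h₂, h₃⟩ := h
  rw [show 2 + i - 1 = 1 + i by lia] at hL
  have hi := Nat.mul_le_mul_left i h₃
  grw [← hL]
  rcases Nat.eq_zero_or_pos r with rfl | hr0
  · rw [min_eq_left (by lia)]
    nlinarith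
  · rw [min_eq_right (by lia)]
    nlinarith

theorem frob_le_of_forall_mem {n c : ℕ} (h : ∀ m, c < m → m ∈ S n) : frob n ≤ c := by
  by_contra! hlt
  exact frob_notMem n (h _ hlt)

theorem one_add_frob_le_of_nthPrime_eq_two {n : ℕ} (h2 : nthPrime n = 2) :
    1 + frob n ≤ e n * (leftElements n).card := by
  have hf : frob n ≤ 1 := by
    refine frob_le_of_forall_mem fun m hm => ?_
    have h2S : 2 ∈ S n := prime_mem_S Nat.prime_two (by lia)
    have h3S : 3 ∈ S n := prime_mem_S Nat.prime_three (by lia)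
    obtain ⟨k, hk | hk⟩ : ∃ k, m = k * 2 ∨ m = k * 2 + 3 := ⟨(m - 3 * (m % 2)) / 2, by lia⟩
    · exact hk ▸ mul_mem_S k h2S
    · exact hk ▸ add_mem (mul_mem_S k h2S) h3S
  have he : ({2, 3} : Finset ℕ).card ≤ e n := card_le_e fun q hq => by
    simp only [Finset.mem_insert, Finset.mem_singleton] at hq
    rcases hq with rfl | rfl <;>
      exact prime_mem_atoms_of_lt_two_mul (by norm_num) (by lia) (by lia)
  have hL : ({0} : Finset ℕ).card ≤ (leftElements n).card :=
    Finset.card_le_card fun q hq => mem_leftElements.2 <| by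
      rw [Finset.mem_singleton.1 hq]
      exact ⟨by lia, zero_mem _⟩
  grw [← he, ← hL, hf]
  decide

theorem one_add_frob_le_of_nthPrime_eq_three {n : ℕ} (h3 : nthPrime n = 3) :
    1 + frob n ≤ e n * (leftElements n).card := by
  have h3S : 3 ∈ S n := prime_mem_S Nat.prime_three (by lia)
  have hf : frob n ≤ 4 := by
    refine frob_le_of_forall_mem fun m hm => ?_
    have h5S : 5 ∈ S n := prime_mem_S Nat.prime_five (by lia)
    have h7S : 7 ∈ S n := prime_mem_S (by norm_num) (by lia)
    obtain ⟨k, hk | hk | hk⟩ : ∃ k, m = k * 3 ∨ m = k * 3 + 7 ∨ m = k * 3 + 5 := by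
      obtain h | h | h : m % 3 = 0 ∨ m % 3 = 1 ∨ m % 3 = 2 := by lia
      · exact ⟨m / 3, by lia⟩
      · exact ⟨(m - 7) / 3, by lia⟩
      · exact ⟨(m - 5) / 3, by lia⟩
    · exact hk ▸ mul_mem_S k h3S
    · exact hk ▸ add_mem (mul_mem_S k h3S) h7S
    · exact hk ▸ add_mem (mul_mem_S k h3S) h5S
  have hf' : 4 ≤ frob n := by
    refine le_frob fun h => ?_
    rcases mem_S_cases (by lia) h with h | ⟨h, -, -⟩ | ⟨-, h⟩ | h
    · lia
    · exact absurd h (by norm_num)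
    · lia
    · lia
  have he : ({3, 5, 7} : Finset ℕ).card ≤ e n := card_le_e fun q hq => by
    simp only [Finset.mem_insert, Finset.mem_singleton] at hq
    rcases hq with rfl | rfl | rfl <;>
      exact prime_mem_atoms_of_lt_three_mul (by lia) (by norm_num) (by lia) (by lia)
  have hL : ({0, 3} : Finset ℕ).card ≤ (leftElements n).card :=
    Finset.card_le_card fun q hq => mem_leftElements.2 <| by
      simp only [Finset.mem_insert, Finset.mem_singleton] at hq
      rcases hq with rfl | rfl
      · exact ⟨by lia, zero_mem _⟩
      · exact ⟨by lia, h3S⟩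
  grw [← he, ← hL, hf]
  decide

theorem one_add_frob_le (n : ℕ) : 1 + frob n ≤ e n * (leftElements n).card := by
  have hp := prime_nthPrime n
  by_cases h2 : nthPrime n = 2
  · exact one_add_frob_le_of_nthPrime_eq_two h2
  by_cases h3 : nthPrime n = 3
  · exact one_add_frob_le_of_nthPrime_eq_three h3
  have h5 : 5 ≤ nthPrime n := hp.five_le_of_ne_two_of_ne_three h2 h3
  have hf : 1 + frob n =
      (1 + frob n) / nthPrime n * nthPrime n + (1 + frob n) % nthPrime n :=
    (Nat.div_add_mod' _ _).symm
  have hj : 2 ≤ (1 + frob n) / nthPrime n :=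
    (Nat.le_div_iff_mul_le hp.pos).2 (two_mul_le_frob h5)
  have he : (primesIn (nthPrime n) (3 * nthPrime n)).card ≤ e n := card_le_e fun q hq => by
    obtain ⟨⟨h, h'⟩, hq⟩ := mem_primesIn.1 hq
    exact prime_mem_atoms_of_lt_three_mul (by lia) hq h h'
  calc 1 + frob n = _ := hf
    _ ≤ _ := mul_le_of_wilfCounts ((wilfCounts_card_primesIn hp h5).mono le_rfl he) hj
      (Nat.mod_lt _ hp.pos) (card_le_card_leftElements hj hf)

theorem wilf_for_S (n : ℕ) (hn : 1 ≤ n) :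
    (genus n : ℝ) / (1 + frob n : ℝ) ≤ ((e n : ℝ) - 1) / (e n : ℝ) ∧
      e n * (1 + frob n - genus n) ≥ 1 + frob n := by
  have h := one_add_frob_le n
  have hg := genus_add_card_leftElements n
  have he : 0 < e n := Nat.pos_of_ne_zero fun h0 => by
    rw [h0, zero_mul] at h
    lia
  refine ⟨?_, ?_⟩
  · rw [div_le_div_iff₀ (by positivity) (by exact_mod_cast he)]
    have h' : (1 + frob n : ℝ) ≤ e n * (leftElements n).card := by exact_mod_cast h
    have hg' : (genus n + (leftElements n).card : ℝ) = 1 + frob n := by exact_mod_cast hg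
    rw [← hg'] at h' ⊢
    linarith
  · rwa [show 1 + frob n - genus n = (leftElements n).card by lia]
end
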